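/- Fix probability vectors p = (p_w, p_d, p_ℓ) and q = (q_w, q_d, q_ℓ) with p_d = q_d = 0 and assume Player 1 is weak, i.e. p_w ≤ p_ℓ and q_w ≤ q_ℓ. If additionally Player 1 is strictly weak (p_w < p_ℓ and q_w < q_ℓ), then for every horizon N ≥ 1 the optimal gain is strictly negative: g*_N < 0. -/

import Mathlib

noncomputable section

open Filter Topology Finset

/-- The sign of an integer score, as a real number (`sgn 0 = 0`). -/
def sgn (x : ℤ) : ℝ := if 0 < x then 1 else if x < 0 then -1 else 0

/-- Expected sign of the score after one more game played with win/draw/loss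
probabilities `w, d, l`, starting from score `x`. -/
def stepVal (w d l : ℝ) (x : ℤ) : ℝ := w * sgn (x + 1) + d * sgn x + l * sgn (x - 1)

/-- Bellman value function with `k` games remaining: `bellman p q k x = V_{N-k}^N(x)`.
With no game remaining the value is the sign of the score; otherwise Player 1 picks the
better of the offensive style `(pw, pd, pl)` and the defensive style `(qw, qd, ql)`. -/
def bellman (pw pd pl qw qd ql : ℝ) : ℕ → ℤ → ℝ
  | 0, x => sgn x
  | k + 1, x =>
      max
        (pw * bellman pw pd pl qw qd ql k (x + 1) + pd * bellman pw pd pl qw qd ql k x +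
          pl * bellman pw pd pl qw qd ql k (x - 1))
        (qw * bellman pw pd pl qw qd ql k (x + 1) + qd * bellman pw pd pl qw qd ql k x +
          ql * bellman pw pd pl qw qd ql k (x - 1))

/-- Optimal gain over `N` games: `g*_N = V_0^N(0)`. -/
def gOpt (pw pd pl qw qd ql : ℝ) (N : ℕ) : ℝ := bellman pw pd pl qw qd ql N 0

/-- The two playing styles of Player 1. -/
inductive Style
  | offense
  | defense
deriving DecidableEq

/-- Selects the probability attached to a style: `a` for offense, `b` for defense. -/
def styleP (a b : ℝ) : Style → ℝ
  | .offense => a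
  | .defense => b

/-- Probability mass function of the score process `X_n` under the policy `π`
(playing `π n x` at round `n+1` when the current score is `x`), started at `X_0 = 0`. -/
def polDist (pw pd pl qw qd ql : ℝ) (π : ℕ → ℤ → Style) : ℕ → ℤ → ℝ
  | 0, x => if x = 0 then 1 else 0
  | n + 1, x =>
      polDist pw pd pl qw qd ql π n (x - 1) * styleP pw qw (π n (x - 1)) +
      polDist pw pd pl qw qd ql π n x * styleP pd qd (π n x) +
      polDist pw pd pl qw qd ql π n (x + 1) * styleP pl ql (π n (x + 1))

/-- Gain of policy `π` over `n` games: `g_n^π = E[sign (X_n)]`. -/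
def gPol (pw pd pl qw qd ql : ℝ) (π : ℕ → ℤ → Style) (n : ℕ) : ℝ :=
  ∑' x : ℤ, polDist pw pd pl qw qd ql π n x * sgn x

/-- Probability mass function of the pair (score, switched-to-defense flag) under the
catenaccio policy: play offense until the score first reaches `+1`, then defense forever. -/
def catDist (pw pd pl qw qd ql : ℝ) : ℕ → ℤ → Bool → ℝ
  | 0, x, b => if x = 0 ∧ b = false then 1 else 0
  | n + 1, x, true =>
      catDist pw pd pl qw qd ql n (x - 1) true * qw +
      catDist pw pd pl qw qd ql n x true * qd +
      catDist pw pd pl qw qd ql n (x + 1) true * ql +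
      (if x = 1 then
        catDist pw pd pl qw qd ql n 0 false * pw +
        catDist pw pd pl qw qd ql n 1 false * pd +
        catDist pw pd pl qw qd ql n 2 false * pl
       else 0)
  | n + 1, x, false =>
      if x = 1 then 0
      else
        catDist pw pd pl qw qd ql n (x - 1) false * pw +
        catDist pw pd pl qw qd ql n x false * pd +
        catDist pw pd pl qw qd ql n (x + 1) false * pl

/-- Gain of the catenaccio policy over `N` games: `g_N^(cat) = E[sign (X_N)]`. -/
def gCat (pw pd pl qw qd ql : ℝ) (N : ℕ) : ℝ :=
  ∑' x : ℤ,
    (catDist pw pd pl qw qd ql N x false + catDist pw pd pl qw qd ql N x true) * sgn x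

/-- Gain of the catenaccio+ policy over `N` games: play catenaccio, except that if the
score after `N - 1` games is `0`, the last game is played with the better of the two
styles (offense if `pw - pl > qw - ql`, defense otherwise). -/
def gCatPlus (pw pd pl qw qd ql : ℝ) : ℕ → ℝ
  | 0 => 0
  | N + 1 =>
      ∑' x : ℤ,
        (catDist pw pd pl qw qd ql N x false *
            (if x = 0 then (if pw - pl > qw - ql then pw - pl else qw - ql)
             else stepVal pw pd pl x) +
          catDist pw pd pl qw qd ql N x true *
            (if x = 0 then (if pw - pl > qw - ql then pw - pl else qw - ql)
             else stepVal qw qd ql x))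

/-- Probability mass function of the lazy random walk with i.i.d. increments (+1 with
probability `qw`, 0 with probability `qd`, −1 with probability `ql`), started at `0`. -/
def walkDist (qw qd ql : ℝ) : ℕ → ℤ → ℝ
  | 0, x => if x = 0 then 1 else 0
  | n + 1, x =>
      walkDist qw qd ql n (x - 1) * qw + walkDist qw qd ql n x * qd +
        walkDist qw qd ql n (x + 1) * ql

/-- Fixed-style gain over `N` games for the walk with step law `(qw, qd, ql)`. -/
def gFixed (qw qd ql : ℝ) (N : ℕ) : ℝ := ∑' x : ℤ, walkDist qw qd ql N x * sgn x

/-- Probability mass function of the lazy random walk with step law `(pw, pd, pl)`,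
started at `0` and absorbed (stopped) at the level `+1`.  In particular
`stoppedDist pw pd pl n 1` is the probability that the walk reaches `+1` by time `n`. -/
def stoppedDist (pw pd pl : ℝ) : ℕ → ℤ → ℝ
  | 0, x => if x = 0 then 1 else 0
  | n + 1, x =>
      if x = 1 then
        stoppedDist pw pd pl n 1 + stoppedDist pw pd pl n 0 * pw +
          stoppedDist pw pd pl n 2 * pl
      else
        (if x - 1 = 1 then 0 else stoppedDist pw pd pl n (x - 1) * pw) +
          stoppedDist pw pd pl n x * pd +
          (if x + 1 = 1 then 0 else stoppedDist pw pd pl n (x + 1) * pl)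
theorem sgn_monotone : Monotone sgn := by
  intro x y h
  unfold sgn
  split_ifs <;> first | omega | norm_num

theorem sgn_add_sgn_neg (x : ℤ) : sgn x + sgn (-x) = 0 := by
  unfold sgn
  split_ifs <;> first | omega | norm_num

theorem bellman_monotone {pw pd pl qw qd ql : ℝ}
    (hpw : 0 ≤ pw) (hpd : 0 ≤ pd) (hpl : 0 ≤ pl)
    (hqw : 0 ≤ qw) (hqd : 0 ≤ qd) (hql : 0 ≤ ql) (k : ℕ) :
    Monotone (bellman pw pd pl qw qd ql k) := by
  induction k with
  | zero => exact sgn_monotone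
  | succ k ih =>
    intro x y h
    have h₁ := ih (add_le_add_left h 1)
    have h₂ := ih h
    have h₃ := ih (sub_le_sub_right h 1)
    simp only [bellman]
    gcongr

/-- Without draws the better style is, at every score, the one that wins more often. -/
theorem bellman_succ_of_no_draws {pw qw : ℝ} (hpw : 0 ≤ pw) (hpw' : pw ≤ 1)
    (hqw : 0 ≤ qw) (hqw' : qw ≤ 1) (k : ℕ) (x : ℤ) :
    bellman pw 0 (1 - pw) qw 0 (1 - qw) (k + 1) x =
      max pw qw * bellman pw 0 (1 - pw) qw 0 (1 - qw) k (x + 1) +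
        (1 - max pw qw) * bellman pw 0 (1 - pw) qw 0 (1 - qw) k (x - 1) := by
  have hm : bellman pw 0 (1 - pw) qw 0 (1 - qw) k (x - 1) ≤
      bellman pw 0 (1 - pw) qw 0 (1 - qw) k (x + 1) :=
    bellman_monotone hpw le_rfl (sub_nonneg.2 hpw') hqw le_rfl (sub_nonneg.2 hqw') k (by lia)
  rw [bellman]
  rcases le_total pw qw with h | h
  · rw [max_eq_right h, max_eq_right] <;> nlinarith
  · rw [max_eq_left h, max_eq_left] <;> nlinarith

section WeakRecursion

variable {V : ℕ → ℤ → ℝ} {w : ℝ}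

theorem add_neg_nonpos_of_weak_recursion (hw : 0 ≤ w) (hw' : w ≤ 1 / 2)
    (hmono : ∀ k, Monotone (V k)) (h₀ : ∀ x, V 0 x + V 0 (-x) ≤ 0)
    (hrec : ∀ k x, V (k + 1) x = w * V k (x + 1) + (1 - w) * V k (x - 1))
    (k : ℕ) (x : ℤ) : V k x + V k (-x) ≤ 0 := by
  induction k generalizing x with
  | zero => exact h₀ x
  | succ k ih =>
    wlog hx : 0 ≤ x generalizing x
    · simpa [add_comm] using this (-x) (by lia)
    have h₁ := ih (x + 1)
    have h₂ := ih (x - 1)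
    have h₃ : V k (-(x + 1)) ≤ V k (-(x - 1)) := hmono k (by lia)
    rw [hrec, hrec, show -x + 1 = -(x - 1) by ring, show -x - 1 = -(x + 1) by ring]
    nlinarith

theorem apply_neg_one_neg_of_weak_recursion (hw : 0 ≤ w) (hw' : w ≤ 1 / 2)
    (hmono : ∀ k, Monotone (V k)) (h₀ : ∀ x, V 0 x + V 0 (-x) ≤ 0) (h₁ : V 0 (-1) < 0)
    (hrec : ∀ k x, V (k + 1) x = w * V k (x + 1) + (1 - w) * V k (x - 1))
    (k : ℕ) : V k (-1) < 0 := by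
  induction k with
  | zero => exact h₁
  | succ k ih =>
    have hz : V k 0 ≤ 0 := by
      have := add_neg_nonpos_of_weak_recursion hw hw' hmono h₀ hrec k 0
      rw [neg_zero] at this
      linarith
    have hle : V k (-1 - 1) ≤ V k (-1) := hmono k (by lia)
    rw [hrec, neg_add_cancel]
    nlinarith

theorem apply_zero_neg_of_weak_recursion (hw : 0 ≤ w) (hw' : w < 1 / 2)
    (hmono : ∀ k, Monotone (V k)) (h₀ : ∀ x, V 0 x + V 0 (-x) ≤ 0) (h₁ : V 0 (-1) < 0)
    (hrec : ∀ k x, V (k + 1) x = w * V k (x + 1) + (1 - w) * V k (x - 1))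
    (k : ℕ) : V (k + 1) 0 < 0 := by
  have ha := add_neg_nonpos_of_weak_recursion hw hw'.le hmono h₀ hrec k 1
  have hb := apply_neg_one_neg_of_weak_recursion hw hw'.le hmono h₀ h₁ hrec k
  rw [hrec, zero_add, zero_sub]
  nlinarith

end WeakRecursion

/-- If there are no draws (`pd = qd = 0`) and Player 1 is strictly
weak (`pw < pl` and `qw < ql`), then the optimal gain is strictly negative for every
horizon `N ≥ 1`. -/
theorem gOpt_neg_of_no_draws_strictly_weak
    (pw pd pl qw qd ql : ℝ)
    (hpw : 0 ≤ pw) (hpd : 0 ≤ pd) (hpl : 0 ≤ pl) (hp : pw + pd + pl = 1)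
    (hqw : 0 ≤ qw) (hqd : 0 ≤ qd) (hql : 0 ≤ ql) (hq : qw + qd + ql = 1)
    (hpd0 : pd = 0) (hqd0 : qd = 0)
    (hweakp : pw ≤ pl) (hweakq : qw ≤ ql)
    (hslosep : pw < pl) (hsloseq : qw < ql)
    (N : ℕ) (hN : 1 ≤ N) :
    gOpt pw pd pl qw qd ql N < 0 := by
  subst hpd0 hqd0
  obtain rfl : pl = 1 - pw := by linarith
  obtain rfl : ql = 1 - qw := by linarith
  obtain ⟨k, rfl⟩ := Nat.exists_eq_add_of_le' hN
  exact apply_zero_neg_of_weak_recursion (le_max_of_le_left hpw)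
    (max_lt (by linarith) (by linarith))
    (bellman_monotone hpw le_rfl hpl hqw le_rfl hql)
    (fun x => (sgn_add_sgn_neg x).le) (by norm_num [bellman, sgn])
    (bellman_succ_of_no_draws hpw (by linarith) hqw (by linarith)) k
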